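/- Let K be a field that is algebraically closed and complete with respect to a nontrivial nonarchimedean multiplicative absolute value |·|, and let 0 < ε < 1 be a real number. Let w : ℤ × ℤ → K be a family of coefficients such that for all x₁, x₂ ∈ K with ε ≤ |x₁| ≤ ε^{-1} and ε ≤ |x₂| ≤ ε^{-1}, the family (w(j,k) x₁^j x₂^k)_{(j,k) ∈ ℤ × ℤ} is summable and |Σ_{(j,k)} w(j,k) x₁^j x₂^k| ≤ 1. Then |w(j,k)| ≤ ε^{|j|+|k|} for all j, k ∈ ℤ. [This is the coefficient bound for the two-variable Laurent series of a function bounded by 1 on a product of annuli, used in the proof of the key approximation lemma.] -/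

import Mathlib

/-- The annulus `ε ≤ ‖x‖ ≤ ε⁻¹` contains points at which `‖x ^ j‖` is at least `δ ^ (-|j|)`, for every
`δ > ε`. The norm of `K` need not take the value `ε` itself. -/
theorem exists_norm_zpow_ge {K : Type*} [NontriviallyNormedField K] [IsAlgClosed K]
    {ε δ : ℝ} (hε0 : 0 < ε) (hεδ : ε < δ) (hδ : δ ≤ 1) (j : ℤ) :
    ∃ x : K, ε ≤ ‖x‖ ∧ ‖x‖ ≤ ε⁻¹ ∧ (δ ^ j.natAbs)⁻¹ ≤ ‖x ^ j‖ := by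
  obtain ⟨x, hx1, hx2⟩ : ∃ x : K, ε ≤ ‖x‖ ∧ ‖x‖ ≤ δ := by
    obtain ⟨c, hc⟩ := NormedField.exists_one_lt_norm K
    obtain ⟨N, hN⟩ := pow_unbounded_of_one_lt ‖c‖ ((one_lt_div hε0).2 hεδ)
    have hN0 : N ≠ 0 := by
      rintro rfl
      simp only [pow_zero] at hN
      linarith
    obtain ⟨y, hy⟩ := IsAlgClosed.exists_pow_nat_eq c (Nat.pos_of_ne_zero hN0)
    have hyN : ‖y‖ ^ N = ‖c‖ := by rw [← norm_pow, hy]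
    have hy1 : 1 < ‖y‖ := by
      by_contra! h
      have := pow_le_one₀ (n := N) (norm_nonneg y) h
      linarith
    have hy2 : ‖y‖ < δ / ε := by
      rw [← hyN] at hN
      exact lt_of_pow_lt_pow_left₀ N (div_pos (hε0.trans hεδ) hε0).le hN
    obtain ⟨m, hm1, hm2⟩ := exists_mem_Ico_zpow hε0 hy1
    refine ⟨y ^ (m + 1), by rw [norm_zpow]; exact hm2.le, ?_⟩
    rw [norm_zpow, zpow_add_one₀ (one_pos.trans hy1).ne']
    calc ‖y‖ ^ m * ‖y‖ ≤ ε * (δ / ε) := by gcongr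
      _ = δ := by field_simp
  have hx0 : 0 < ‖x‖ := hε0.trans_le hx1
  have hε1 : 1 ≤ ε⁻¹ := (one_le_inv₀ hε0).2 (hεδ.le.trans hδ)
  have key : (δ ^ j.natAbs)⁻¹ ≤ (‖x‖ ^ j.natAbs)⁻¹ := by gcongr
  rcases le_total 0 j with hj | hj
  · refine ⟨x⁻¹, ?_, ?_, key.trans_eq ?_⟩
    · rw [norm_inv]
      exact (hεδ.le.trans hδ).trans ((one_le_inv₀ hx0).2 (hx2.trans hδ))
    · rw [norm_inv]
      gcongr
    · obtain ⟨n, rfl⟩ := Int.eq_ofNat_of_zero_le hj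
      simp
  · refine ⟨x, hx1, (hx2.trans hδ).trans hε1, key.trans_eq ?_⟩
    obtain ⟨n, hn⟩ := Int.eq_ofNat_of_zero_le (neg_nonneg.2 hj)
    obtain rfl : j = -(n : ℤ) := by omega
    simp

theorem exists_gt_norm_natCast_eq_one (K : Type*) [NormedField K] [IsUltrametricDist K] (N : ℕ) :
    ∃ n : ℕ, N < n ∧ ‖(n : K)‖ = 1 := by
  by_cases h : ‖((N + 1 : ℕ) : K)‖ = 1
  · exact ⟨N + 1, N.lt_succ_self, h⟩
  · have hlt := lt_of_le_of_ne (IsUltrametricDist.norm_natCast_le_one K (N + 1)) h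
    refine ⟨N + 2, by omega, ?_⟩
    have h2 : ((N + 2 : ℕ) : K) = ((N + 1 : ℕ) : K) + 1 := by push_cast; ring
    rw [h2, IsUltrametricDist.norm_add_eq_max_of_norm_ne_norm (by simpa using h), norm_one]
    exact max_eq_right hlt.le

theorem IsPrimitiveRoot.sum_zpow_pow_eq_zero {K : Type*} [Field K] {ζ : K} {n : ℕ}
    (hζ : IsPrimitiveRoot ζ n) {m : ℤ} (hm : ¬ (n : ℤ) ∣ m) :
    ∑ a ∈ Finset.range n, (ζ ^ a) ^ m = 0 := by
  have h1 : ζ ^ m ≠ 1 := fun h => hm ((hζ.zpow_eq_one_iff_dvd m).1 h)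
  have h2 : ∀ a : ℕ, (ζ ^ a) ^ m = (ζ ^ m) ^ a := fun a => by
    rw [← zpow_natCast, ← zpow_natCast, zpow_comm]
  simp_rw [h2]
  rw [geom_sum_eq h1, ← h2, hζ.pow_eq_one, one_zpow, sub_self, zero_div]

/-- Cauchy's estimate on the unit torus. -/
theorem norm_coeff_le_one_of_norm_tsum_le_one {K : Type*} [NontriviallyNormedField K]
    [IsUltrametricDist K] [IsAlgClosed K] (u : ℤ × ℤ → K)
    (hu : ∀ y z : K, ‖y‖ = 1 → ‖z‖ = 1 →
      Summable (fun p : ℤ × ℤ => u p * y ^ p.1 * z ^ p.2) ∧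
        ‖∑' p : ℤ × ℤ, u p * y ^ p.1 * z ^ p.2‖ ≤ 1) (j k : ℤ) :
    ‖u (j, k)‖ ≤ 1 := by
  have hsum : Summable u := by simpa using (hu 1 1 norm_one norm_one).1
  have hfin : {p | ¬ ‖u p‖ < 1}.Finite := by
    have h := hsum.tendsto_cofinite_zero.norm
    rw [norm_zero] at h
    exact h.eventually_lt_const one_pos
  obtain ⟨N, hN⟩ : ∃ N : ℕ, ∀ p : ℤ × ℤ, ¬ ‖u p‖ < 1 →
      (p.1 - j).natAbs + (p.2 - k).natAbs ≤ N := by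
    obtain ⟨N, hN⟩ :=
      (hfin.image fun p : ℤ × ℤ => (p.1 - j).natAbs + (p.2 - k).natAbs).bddAbove
    exact ⟨N, fun p hp => hN ⟨p, hp, rfl⟩⟩
  obtain ⟨n, hNn, hn⟩ := exists_gt_norm_natCast_eq_one K N
  have hn0 : n ≠ 0 := by omega
  have : NeZero (n : K) := ⟨norm_ne_zero_iff.1 (by rw [hn]; exact one_ne_zero)⟩
  obtain ⟨ζ, hζ⟩ := HasEnoughRootsOfUnity.exists_primitiveRoot K n
  have hζ1 : ‖ζ‖ = 1 := (pow_eq_one_iff_of_nonneg (norm_nonneg ζ) hn0).1 (by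
    rw [← norm_pow, hζ.pow_eq_one, norm_one])
  have hζ0 : ∀ a : ℕ, ζ ^ a ≠ 0 := fun a => pow_ne_zero _ (hζ.ne_zero hn0)
  have hζa : ∀ a : ℕ, ‖ζ ^ a‖ = 1 := fun a => by rw [norm_pow, hζ1, one_pow]
  set g : ℤ → K := fun m => ∑ a ∈ Finset.range n, (ζ ^ a) ^ m with hg
  have hg1 : ∀ m, ‖g m‖ ≤ 1 := fun m =>
    IsUltrametricDist.norm_sum_le_of_forall_le_of_nonneg zero_le_one fun a _ => by
      rw [norm_zpow, hζa, one_zpow]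
  have hg0 : g 0 = n := by simp [hg]
  set S : K := ∑ a ∈ Finset.range n, ∑ b ∈ Finset.range n,
    (ζ ^ a) ^ (-j) * (ζ ^ b) ^ (-k) * ∑' p : ℤ × ℤ, u p * (ζ ^ a) ^ p.1 * (ζ ^ b) ^ p.2 with hS
  have hS1 : ‖S‖ ≤ 1 :=
    IsUltrametricDist.norm_sum_le_of_forall_le_of_nonneg zero_le_one fun a _ =>
      IsUltrametricDist.norm_sum_le_of_forall_le_of_nonneg zero_le_one fun b _ => by
        rw [norm_mul, norm_mul, norm_zpow, norm_zpow, hζa, hζa, one_zpow, one_zpow, one_mul,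
          one_mul]
        exact (hu _ _ (hζa a) (hζa b)).2
  have hasSum : HasSum (fun p : ℤ × ℤ => u p * (g (p.1 - j) * g (p.2 - k))) S := by
    have h := hasSum_sum fun a (_ : a ∈ Finset.range n) =>
      hasSum_sum fun b (_ : b ∈ Finset.range n) =>
        ((hu _ _ (hζa a) (hζa b)).1.hasSum.mul_left ((ζ ^ a) ^ (-j) * (ζ ^ b) ^ (-k)))
    refine (congrArg (HasSum · S) (funext fun p => ?_)).mpr h
    simp only [hg]
    rw [Finset.sum_mul_sum, Finset.mul_sum]
    refine Finset.sum_congr rfl fun a _ => ?_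
    rw [Finset.mul_sum]
    refine Finset.sum_congr rfl fun b _ => ?_
    rw [sub_eq_add_neg, sub_eq_add_neg, zpow_add₀ (hζ0 a), zpow_add₀ (hζ0 b)]
    ring
  have hrest := hasSum.update (j, k) 0
  have hle : ‖0 - u (j, k) * (g (j - j) * g (k - k)) + S‖ ≤ 1 := by
    rw [← hrest.tsum_eq]
    refine IsUltrametricDist.norm_tsum_le_of_forall_le_of_nonneg zero_le_one fun p => ?_
    by_cases hp : p = (j, k)
    · simp [hp]
    rw [Function.update_of_ne hp]
    by_cases hup : ‖u p‖ < 1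
    · rw [norm_mul, norm_mul]
      exact mul_le_one₀ hup.le (by positivity)
        (mul_le_one₀ (hg1 _) (norm_nonneg _) (hg1 _))
    · have hb := hN p hup
      have hz : g (p.1 - j) * g (p.2 - k) = 0 := by
        by_contra hne
        obtain ⟨h1, h2⟩ := mul_ne_zero_iff.1 hne
        have d1 := not_not.1 (mt hζ.sum_zpow_pow_eq_zero h1)
        have d2 := not_not.1 (mt hζ.sum_zpow_pow_eq_zero h2)
        have e1 := Int.eq_zero_of_dvd_of_natAbs_lt_natAbs d1 (by omega)
        have e2 := Int.eq_zero_of_dvd_of_natAbs_lt_natAbs d2 (by omega)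
        exact hp (Prod.ext (sub_eq_zero.1 e1) (sub_eq_zero.1 e2))
      simp [hz]
  have heq : ‖u (j, k)‖ = ‖S - (0 - u (j, k) * (g (j - j) * g (k - k)) + S)‖ := by
    rw [show S - (0 - u (j, k) * (g (j - j) * g (k - k)) + S) =
      u (j, k) * (g (j - j) * g (k - k)) by ring]
    simp [hg0, hn]
  rw [heq, sub_eq_add_neg]
  exact (IsUltrametricDist.norm_add_le_max _ _).trans (max_le hS1 (by rwa [norm_neg]))


/-- Let `K` be an algebraically closed field, complete with respect to a
nontrivial nonarchimedean multiplicative absolute value, and let `0 < ε < 1`. If the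
two-variable Laurent series with coefficients `w : ℤ × ℤ → K` is summable at each point
`(x₁, x₂)` of the product of annuli `ε ≤ |xᵢ| ≤ ε⁻¹`, with values of absolute value at most
`1`, then `|w(j,k)| ≤ ε^(|j|+|k|)` for all `j, k ∈ ℤ`. -/
theorem stmt_8 {K : Type*} [NontriviallyNormedField K] [CompleteSpace K]
    [IsUltrametricDist K] [IsAlgClosed K] (ε : ℝ) (hε0 : 0 < ε) (hε1 : ε < 1)
    (w : ℤ × ℤ → K)
    (hw : ∀ x₁ x₂ : K, ε ≤ ‖x₁‖ → ‖x₁‖ ≤ ε⁻¹ → ε ≤ ‖x₂‖ → ‖x₂‖ ≤ ε⁻¹ →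
      Summable (fun p : ℤ × ℤ => w p * x₁ ^ p.1 * x₂ ^ p.2) ∧
        ‖∑' p : ℤ × ℤ, w p * x₁ ^ p.1 * x₂ ^ p.2‖ ≤ 1) :
    ∀ j k : ℤ, ‖w (j, k)‖ ≤ ε ^ (j.natAbs + k.natAbs) := by
  intro j k
  have hδ : ∀ δ : ℝ, ε < δ → δ ≤ 1 → ‖w (j, k)‖ ≤ δ ^ (j.natAbs + k.natAbs) := by
    intro δ hεδ hδ1
    have hδ0 : 0 < δ := hε0.trans hεδ
    obtain ⟨x, hx1, hx2, hxj⟩ := exists_norm_zpow_ge (K := K) hε0 hεδ hδ1 j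
    obtain ⟨y, hy1, hy2, hyk⟩ := exists_norm_zpow_ge (K := K) hε0 hεδ hδ1 k
    have h := norm_coeff_le_one_of_norm_tsum_le_one
      (fun p : ℤ × ℤ => w p * x ^ p.1 * y ^ p.2) (fun s t hs ht => by
        have h := hw (x * s) (y * t) (by simpa [hs] using hx1) (by simpa [hs] using hx2)
          (by simpa [ht] using hy1) (by simpa [ht] using hy2)
        have e : (fun p : ℤ × ℤ => w p * x ^ p.1 * y ^ p.2 * s ^ p.1 * t ^ p.2) =
            fun p : ℤ × ℤ => w p * (x * s) ^ p.1 * (y * t) ^ p.2 := by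
          funext p
          rw [mul_zpow, mul_zpow]
          ring
        rwa [e]) j k
    rw [norm_mul, norm_mul] at h
    have h' : ‖w (j, k)‖ * (δ ^ j.natAbs)⁻¹ * (δ ^ k.natAbs)⁻¹ ≤ 1 :=
      le_trans (by gcongr) h
    rw [pow_add]
    rwa [mul_assoc, ← mul_inv, ← div_eq_mul_inv, div_le_one (by positivity)] at h'
  have hlim : Filter.Tendsto (fun δ : ℝ => δ ^ (j.natAbs + k.natAbs)) (nhdsWithin ε (Set.Ioi ε))
      (nhds (ε ^ (j.natAbs + k.natAbs))) :=
    ((continuous_pow _).tendsto ε).mono_left nhdsWithin_le_nhds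
  refine ge_of_tendsto hlim ?_
  filter_upwards [Ioc_mem_nhdsGT hε1] with δ h
  exact hδ δ h.1 h.2
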